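/- Let q be a prime power, let n ≥ 2, let V be an n-dimensional vector space over the finite field 𝔽_q, and let t = (q^n − 1)/(q − 1) denote the number of 1-dimensional subspaces of V. Suppose (F, α) is an irreducible λ-partition of V for some positive integer λ. Then, as real numbers, |F| ≤ (t+1)^{(t+1)/2}. -/

import Mathlib

open Finset

theorem hadamard_fin (m : ℕ) (M : Matrix (Fin m) (Fin m) ℝ) (hM : ∀ i j, |M i j| ≤ 1) :
    |M.det| ≤ Real.sqrt m ^ m := by
  have : Fact (Module.finrank ℝ (EuclideanSpace ℝ (Fin m)) = m) := ⟨by simp⟩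
  let b := EuclideanSpace.basisFun (Fin m) ℝ
  let o := b.toBasis.orientation
  have h1 := o.abs_volumeForm_apply_le (fun i => WithLp.toLp 2 (M i))
  rw [o.volumeForm_robust b rfl, Module.Basis.det_apply] at h1
  have h2 : b.toBasis.toMatrix (fun i => WithLp.toLp 2 (M i)) = M.transpose := by
    ext i j
    simp [Module.Basis.toMatrix_apply, b]
  rw [h2, Matrix.det_transpose] at h1
  refine h1.trans ?_
  calc ∏ i : Fin m, ‖(WithLp.toLp 2 (M i) : EuclideanSpace ℝ (Fin m))‖
      ≤ ∏ i : Fin m, Real.sqrt m := by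
        refine Finset.prod_le_prod (fun i _ => norm_nonneg _) (fun i _ => ?_)
        rw [EuclideanSpace.norm_eq]
        apply Real.sqrt_le_sqrt
        calc ∑ j, ‖M i j‖ ^ 2 ≤ ∑ j : Fin m, (1 : ℝ) := by
              refine Finset.sum_le_sum (fun j _ => ?_)
              have := hM i j
              rw [Real.norm_eq_abs]
              exact pow_le_one₀ (abs_nonneg _) this
          _ = m := by simp
    _ = Real.sqrt m ^ m := by simp

theorem hadamard_gen {ι : Type*} [Fintype ι] [DecidableEq ι] (M : Matrix ι ι ℝ)
    (hM : ∀ i j, |M i j| ≤ 1) :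
    |M.det| ≤ Real.sqrt (Fintype.card ι) ^ (Fintype.card ι) := by
  have := hadamard_fin (Fintype.card ι)
    (Matrix.reindex (Fintype.equivFin ι) (Fintype.equivFin ι) M) (fun i j => hM _ _)
  rwa [Matrix.det_reindex_self] at this

theorem det_zero_one {P : Type*} [Fintype P] [DecidableEq P] (M : Matrix P P ℝ)
    (hM : ∀ i j, M i j = 0 ∨ M i j = 1) :
    2 ^ Fintype.card P * |M.det| ≤
      Real.sqrt ((Fintype.card P : ℝ) + 1) ^ (Fintype.card P + 1) := by
  let N : Matrix (Unit ⊕ P) (Unit ⊕ P) ℝ :=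
    Matrix.fromBlocks 1 (Matrix.of fun _ _ => 1) (Matrix.of fun _ _ => 1)
      (Matrix.of fun i j => 1 - 2 * M i j)
  have h := hadamard_gen N (by
    rintro (i | i) (j | j)
    · simp [N]
    · simp [N]
    · simp [N]
    · rcases hM i j with h | h <;> norm_num [N, h])
  have hd : N.det = ((-2 : ℝ) • M).det := by
    simp only [N]
    rw [Matrix.det_fromBlocks_one₁₁]
    congr 1
    ext i j
    simp [Matrix.mul_apply]
  rw [hd, Matrix.det_smul, abs_mul, abs_pow] at h
  have hc : Fintype.card (Unit ⊕ P) = Fintype.card P + 1 := by simp [add_comm]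
  rw [hc] at h
  simpa using h

theorem exists_basic {P C : Type*} [Fintype P] [Fintype C] [DecidableEq P]
    (A : C → P → ℕ) (hA : ∀ c p, A c p = 0 ∨ A c p = 1)
    (hspan : Submodule.span ℝ (Set.range (fun c => (fun p => (A c p : ℝ)))) = ⊤)
    (y : C → ℝ) (hy : ∀ c, 0 ≤ y c) (l : ℝ) (hl : 0 < l)
    (hyl : ∀ p, ∑ c, y c * A c p = l) :
    ∃ (e : C → ℕ) (m : ℕ), 0 < m ∧ (∀ c, y c = 0 → e c = 0) ∧ (∀ p, ∑ c, e c * A c p = m) ∧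
      (2 : ℝ) ^ Fintype.card P * ∑ c, (e c : ℝ) ≤
        Fintype.card P * Real.sqrt ((Fintype.card P : ℝ) + 1) ^ (Fintype.card P + 1) := by
  classical
  induction hk : (univ.filter (fun c => y c ≠ 0)).card using Nat.strong_induction_on
    generalizing y with
  | _ k ih =>
  by_cases hli : LinearIndepOn ℝ (fun c => (fun p => (A c p : ℝ))) {c | y c ≠ 0}
  · -- the main case
    obtain ⟨b, hb1, hb2, hb3, hb4⟩ := exists_linearIndepOn_extension hli (Set.subset_univ _)
    have htop : Submodule.span ℝ (Set.range (fun c : b => (fun p => (A c p : ℝ)))) = ⊤ := by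
      rw [eq_top_iff, ← hspan, Submodule.span_le]
      rintro _ ⟨c, rfl⟩
      have := hb3 ⟨c, Set.mem_univ _, rfl⟩
      rw [Set.image_eq_range] at this
      exact this
    have hb4' : LinearIndependent ℝ (fun c : b => (fun p => (A c p : ℝ))) := hb4
    let B := Module.Basis.mk hb4' htop.ge
    have hcard : Fintype.card P = Fintype.card b := by
      rw [← Module.finrank_eq_card_basis B]; simp
    let σ : P ≃ b := Fintype.equivOfCardEq hcard
    let MZ : Matrix P P ℤ := Matrix.of fun p p' => (A (σ p') p : ℤ)
    let M : Matrix P P ℝ := (Int.castRingHom ℝ).mapMatrix MZ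
    have hMe : ∀ p p', M p p' = A (σ p') p := by intro p p'; simp [M, MZ]
    have hdet : M.det ≠ 0 := by
      have : LinearIndependent ℝ M.col := by
        have h := hb4'.comp σ σ.injective
        convert h using 1
        ext p p'
        simp [Matrix.col, hMe]
      rw [Matrix.linearIndependent_cols_iff_isUnit, Matrix.isUnit_iff_isUnit_det] at this
      exact this.ne_zero
    have hMdet : M.det = (MZ.det : ℝ) := by
      simp only [M]; rw [← RingHom.map_det]; simp
    have hsum : ∀ g : C → ℝ, (∀ c, c ∉ b → g c = 0) → ∑ c, g c = ∑ p, g (σ p) := by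
      intro g hg
      rw [Equiv.sum_comp σ (fun c : b => g c)]
      rw [← Finset.sum_subtype (univ.filter (· ∈ b)) (by simp) g]
      · rw [Finset.sum_filter_of_ne]
        intro c _ hc
        by_contra h
        exact hc (hg c h)
    have hyb : ∀ c, c ∉ b → y c = 0 := by
      intro c hc
      by_contra h
      exact hc (hb2 h)
    have hcr : ∀ p, l * M.cramer (fun _ => 1) p = M.det * y (σ p) := by
      have h1 : M.mulVec (l • M.cramer (fun _ => 1)) = M.mulVec (M.det • fun p => y (σ p)) := by
        rw [Matrix.mulVec_smul, Matrix.mulVec_smul, Matrix.mulVec_cramer]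
        ext p
        simp only [Pi.smul_apply, smul_eq_mul, mul_one]
        rw [mul_comm]
        congr 1
        rw [← hyl p, hsum _ (fun c hc => by simp [hyb c hc])]
        simp only [Matrix.mulVec, dotProduct, hMe]
        exact Finset.sum_congr rfl (fun _ _ => mul_comm _ _)
      have hU : IsUnit M := by
        rw [Matrix.isUnit_iff_isUnit_det]; exact hdet.isUnit
      have h2 := Matrix.mulVec_injective_of_isUnit hU h1
      intro p
      exact congrFun h2 p
    set H := Real.sqrt ((Fintype.card P : ℝ) + 1) ^ (Fintype.card P + 1) with hH
    have hH0 : 0 ≤ H := by positivity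
    have hex : ∀ c, ∃ k : ℕ, (k : ℝ) = |M.det| / l * y c ∧ (2 : ℝ) ^ Fintype.card P * k ≤
        if c ∈ b then H else 0 := by
      intro c
      by_cases hc : c ∈ b
      · obtain ⟨p, hp⟩ := σ.surjective ⟨c, hc⟩
        have h1 := hcr p
        rw [hp] at h1
        simp only at h1
        have h2 : |M.cramer (fun _ => 1) p| = |M.det| / l * y c := by
          have : |l * M.cramer (fun _ => 1) p| = |M.det * y c| := by rw [h1]
          rw [abs_mul, abs_mul, abs_of_pos hl, abs_of_nonneg (hy c)] at this
          field_simp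
          linarith
        refine ⟨((MZ.updateCol p (fun _ => 1)).det).natAbs, ?_, ?_⟩ 
        all_goals
          have h3 : (((MZ.updateCol p (fun _ => 1)).det).natAbs : ℝ) =
              |M.cramer (fun _ => 1) p| := by
            rw [Matrix.cramer_apply, Nat.cast_natAbs, Int.cast_abs]
            congr 1
            have : M.updateCol p (fun _ => 1) =
                (Int.castRingHom ℝ).mapMatrix (MZ.updateCol p (fun _ => 1)) := by
              ext i j
              by_cases hj : j = p
              · subst hj; simp
              · simp [Matrix.updateCol_ne hj, M]
            rw [this, ← RingHom.map_det]; simp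
        · rw [h3, h2]
        · rw [h3, if_pos hc, Matrix.cramer_apply]
          apply det_zero_one
          intro i j
          by_cases hj : j = p
          · subst hj; simp
          · rw [Matrix.updateCol_ne hj, hMe]
            exact_mod_cast hA _ _
      · exact ⟨0, by simp [hyb c hc], by simp [hc]⟩
    choose e he1 he2 using hex
    refine ⟨e, MZ.det.natAbs, ?_, ?_, ?_, ?_⟩
    · rw [Int.natAbs_pos]
      intro h
      apply hdet
      rw [hMdet, h]; simp
    · intro c hc
      have := he1 c
      rw [hc, mul_zero] at this
      exact_mod_cast this
    · intro p
      have : ((∑ c, e c * A c p : ℕ) : ℝ) = (MZ.det.natAbs : ℕ) := by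
        push_cast
        rw [Nat.cast_natAbs, Int.cast_abs, ← hMdet]
        simp only [he1, mul_assoc]
        rw [← Finset.mul_sum, hyl p]
        field_simp
      exact_mod_cast this
    · rw [Finset.mul_sum]
      refine (Finset.sum_le_sum (fun c _ => he2 c)).trans ?_
      rw [hsum _ (fun c hc => by simp [hc])]
      simp
  · obtain ⟨f, hf1, hf2, hf3⟩ := linearDepOn_iff.mp hli
    have hg0 : ∀ p, ∑ c, f c * (A c p : ℝ) = 0 := by
      intro p
      have := congrFun hf2 p
      rw [Finset.sum_apply] at this
      rw [← Finset.sum_subset (Finset.subset_univ f.support)]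
      · simpa using this
      · intro c _ hc
        rw [Finsupp.notMem_support_iff.mp hc, zero_mul]
    have hfs : ∀ c, y c = 0 → f c = 0 := by
      intro c hc
      by_contra h
      have := hf1 (Finsupp.mem_support_iff.mpr h)
      exact this hc
    -- get a version with a positive entry
    obtain ⟨g, hg1, hg2, c1, hc1⟩ : ∃ g : C → ℝ, (∀ p, ∑ c, g c * (A c p : ℝ) = 0) ∧
        (∀ c, y c = 0 → g c = 0) ∧ ∃ c, 0 < g c := by
      obtain ⟨c, hc⟩ : ∃ c, f c ≠ 0 := by
        by_contra! h
        exact hf3 (Finsupp.ext h)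
      rcases lt_or_gt_of_ne hc with h | h
      · exact ⟨fun c => - f c, fun p => by simp [hg0], fun c hc => by simp [hfs c hc], c,
          by simpa using h⟩
      · exact ⟨f, hg0, hfs, c, h⟩
    obtain ⟨c0, hc0, hmin⟩ := Finset.exists_min_image (univ.filter (fun c => 0 < g c))
      (fun c => y c / g c) ⟨c1, by simpa using hc1⟩
    simp only [mem_filter, mem_univ, true_and] at hc0 hmin
    have hr : 0 ≤ y c0 / g c0 := div_nonneg (hy _) hc0.le
    have hlt : (univ.filter (fun c => y c - y c0 / g c0 * g c ≠ 0)).card < k := by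
      rw [← hk]
      apply Finset.card_lt_card
      rw [Finset.ssubset_iff_of_subset]
      · refine ⟨c0, ?_, ?_⟩
        · simp only [mem_filter, mem_univ, true_and]
          intro h
          exact hc0.ne' (hg2 _ h)
        · simp [hc0.ne']
      · intro c
        simp only [mem_filter, mem_univ, true_and]
        intro h h'
        apply h
        rw [h', hg2 c h']; simp
    obtain ⟨e, m, h1, h2, h3, h4⟩ := ih _ hlt (fun c => y c - y c0 / g c0 * g c) (by
      intro c
      rcases lt_or_ge 0 (g c) with h | h
      · have := hmin c h
        rw [le_div_iff₀ h] at this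
        simpa using this
      · have := mul_nonpos_of_nonneg_of_nonpos hr h
        have := hy c
        linarith) (by
      intro p
      simp only [sub_mul, Finset.sum_sub_distrib, mul_assoc]
      rw [← Finset.mul_sum, hg1, hyl]; simp) rfl
    exact ⟨e, m, h1, fun c hc => h2 c (by simp [hc, hg2 c hc]), h3, h4⟩

/-- The space of vectors supported in the support of `x` whose image is constant. -/
noncomputable def coneSpace {P C : Type*} [Fintype C] (A : C → P → ℕ) (x : C → ℝ) :
    Submodule ℝ (C → ℝ) where
  carrier := {y | (∀ c, x c = 0 → y c = 0) ∧ ∃ l : ℝ, ∀ p, ∑ c, y c * A c p = l}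
  zero_mem' := ⟨by simp, 0, by simp⟩
  add_mem' := by
    rintro a b ⟨h1, l, h2⟩ ⟨h3, l', h4⟩
    refine ⟨fun c hc => by simp [h1 c hc, h3 c hc], l + l', fun p => ?_⟩
    simp [add_mul, Finset.sum_add_distrib, h2, h4]
  smul_mem' := by
    rintro r a ⟨h1, l, h2⟩
    refine ⟨fun c hc => by simp [h1 c hc], r * l, fun p => ?_⟩
    simp [mul_assoc, ← Finset.mul_sum, h2]

theorem peel {P C : Type*} [Fintype P] [Fintype C] [DecidableEq P] [Nonempty P]
    (A : C → P → ℕ) (hA : ∀ c p, A c p = 0 ∨ A c p = 1) (hne : ∀ c, ∃ p, A c p = 1)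
    (hspan : Submodule.span ℝ (Set.range (fun c => (fun p => (A c p : ℝ)))) = ⊤)
    (d : ℕ) (x : C → ℝ) (hx : ∀ c, 0 ≤ x c) (l : ℝ) (hxl : ∀ p, ∑ c, x c * A c p = l)
    (hd : Module.finrank ℝ (coneSpace A x) ≤ d)
    (hno : ¬ ∃ (e : C → ℕ) (m : ℕ), 0 < m ∧ (∀ p, ∑ c, e c * A c p = m) ∧ 
      (∀ c, (e c : ℝ) ≤ x c) ∧ (2 : ℝ) ^ Fintype.card P * ∑ c, (e c : ℝ) ≤
        Fintype.card P * Real.sqrt ((Fintype.card P : ℝ) + 1) ^ (Fintype.card P + 1)) :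
    (2 : ℝ) ^ Fintype.card P * ∑ c, x c ≤
        d * (Fintype.card P * Real.sqrt ((Fintype.card P : ℝ) + 1) ^ (Fintype.card P + 1)) := by
  induction d generalizing x l with
  | zero =>
    have h0 : coneSpace A x = ⊥ := by
      rw [← Submodule.finrank_eq_zero (R := ℝ)]; omega
    have hx0 : x ∈ coneSpace A x := ⟨fun _ h => h, l, hxl⟩
    rw [h0, Submodule.mem_bot] at hx0
    simp [hx0]
  | succ d ih =>
    obtain ⟨p0⟩ := ‹Nonempty P›
    have hl0 : 0 ≤ l := by
      rw [← hxl p0]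
      exact Finset.sum_nonneg (fun c _ => mul_nonneg (hx c) (Nat.cast_nonneg _))
    rcases hl0.eq_or_lt with hl | hl
    · have : ∀ c, x c = 0 := by
        intro c
        obtain ⟨p, hp⟩ := hne c
        have h := hxl p
        rw [← hl, Finset.sum_eq_zero_iff_of_nonneg
          (fun c _ => mul_nonneg (hx c) (Nat.cast_nonneg _))] at h
        simpa [hp] using h c (mem_univ _)
      simp only [this, Finset.sum_const_zero, mul_zero]
      positivity
    · obtain ⟨e, m, hm, hes, hem, heb⟩ := exists_basic A hA hspan x hx l hl hxl
      obtain ⟨c1, hc1⟩ : ∃ c, 0 < e c := by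
        by_contra! h
        have := hem p0
        rw [Finset.sum_eq_zero] at this
        · omega
        · intro c _
          simp [Nat.le_zero.mp (h c)]
      obtain ⟨c0, hc0, hmin⟩ := Finset.exists_min_image (univ.filter (fun c => 0 < e c))
        (fun c => x c / e c) ⟨c1, by simpa using hc1⟩
      simp only [mem_filter, mem_univ, true_and] at hc0 hmin
      have hc0' : (0 : ℝ) < e c0 := by exact_mod_cast hc0
      set r := x c0 / e c0 with hr
      have hr0 : 0 ≤ r := div_nonneg (hx _) hc0'.le
      have hle : ∀ c, r * e c ≤ x c := by
        intro c
        rcases Nat.eq_zero_or_pos (e c) with h | h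
        · simp [h, hx]
        · have := hmin c h
          rwa [le_div_iff₀ (by exact_mod_cast h)] at this
      have hr1 : r < 1 := by
        by_contra! h
        refine hno ⟨e, m, hm, hem, fun c => ?_, heb⟩
        have : (0 : ℝ) ≤ e c := Nat.cast_nonneg _
        nlinarith [hle c]
      have hemR : ∀ p, ∑ c, (e c : ℝ) * A c p = m := by
        intro p
        exact_mod_cast hem p
      have key := ih (fun c => x c - r * e c) (fun c => by simpa using hle c) (l - r * m) (by
        intro p
        simp only [sub_mul, Finset.sum_sub_distrib, mul_assoc]
        rw [← Finset.mul_sum, hemR, hxl]) (by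
        have : coneSpace A (fun c => x c - r * e c) < coneSpace A x := by
          rw [SetLike.lt_iff_le_and_exists]
          refine ⟨?_, fun c => (e c : ℝ), ⟨fun c hc => by simp [hes c hc], m, hemR⟩, ?_⟩
          · rintro y ⟨hy1, hy2⟩
            refine ⟨fun c hc => hy1 c ?_, hy2⟩
            simp [hc, hes c hc]
          · rintro ⟨h, _⟩
            have := h c0 (by simp only [hr]; field_simp; simp)
            exact hc0'.ne' this
        have := Submodule.finrank_lt_finrank_of_lt this
        omega) (by
        rintro ⟨e', m', h1, h2, h3, h4⟩
        refine hno ⟨e', m', h1, h2, fun c => (h3 c).trans ?_, h4⟩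
        have : 0 ≤ r * (e c : ℝ) := mul_nonneg hr0 (Nat.cast_nonneg _)
        linarith)
      simp only [Finset.sum_sub_distrib, ← Finset.mul_sum] at key
      have hE : (0 : ℝ) ≤ ∑ c, (e c : ℝ) := Finset.sum_nonneg (fun c _ => Nat.cast_nonneg _)
      have h2 : (0 : ℝ) ≤ 2 ^ Fintype.card P * ∑ c, (e c : ℝ) := by positivity
      push_cast
      nlinarith

theorem finrank_cone {P D : Type*} [Fintype P] [Fintype D] [DecidableEq P] [Nonempty P]
    (A : P ⊕ D → P → ℕ) (hI : ∀ p p', A (Sum.inl p) p' = if p = p' then 1 else 0)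
    (x : P ⊕ D → ℝ) : Module.finrank ℝ (coneSpace A x) ≤ Fintype.card D + 1 := by
  obtain ⟨p0⟩ := ‹Nonempty P›
  let φ : (P ⊕ D → ℝ) →ₗ[ℝ] ((D → ℝ) × ℝ) :=
    { toFun := fun y => (fun d => y (Sum.inr d), ∑ c, y c * A c p0)
      map_add' := by
        intro a b
        ext
        · simp
        · simp only [Pi.add_apply, add_mul, Finset.sum_add_distrib, Prod.mk_add_mk]
      map_smul' := by
        intro r a
        ext
        · simp
        · simp only [Pi.smul_apply, smul_eq_mul, mul_assoc, ← Finset.mul_sum, Prod.smul_mk,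
            RingHom.id_apply] }
  have hinj : Function.Injective (φ.comp (coneSpace A x).subtype) := by
    rw [← LinearMap.ker_eq_bot, LinearMap.ker_eq_bot']
    rintro ⟨y, hy1, l, hy2⟩ h
    have h1 : ∀ d, y (Sum.inr d) = 0 := fun d => congrFun (congrArg Prod.fst h) d
    have h2 : ∑ c, y c * A c p0 = 0 := congrArg Prod.snd h
    have hl : l = 0 := by rw [← hy2 p0, h2]
    have h3 : ∀ p, y (Sum.inl p) = 0 := by
      intro p
      have := hy2 p
      rw [hl] at this
      simpa [Fintype.sum_sum_type, h1, hI] using this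
    ext c
    rcases c with c | c
    · simpa using h3 c
    · simpa using h1 c
  have := LinearMap.finrank_le_finrank_of_injective hinj
  simpa using this

theorem abstract_bound {P D : Type*} [Fintype P] [Fintype D] [DecidableEq P] [Nonempty P]
    (A : P ⊕ D → P → ℕ) (hA : ∀ c p, A c p = 0 ∨ A c p = 1) (hne : ∀ c, ∃ p, A c p = 1)
    (hI : ∀ p p', A (Sum.inl p) p' = if p = p' then 1 else 0)
    (x : P ⊕ D → ℕ) (l : ℕ) (hxl : ∀ p, ∑ c, x c * A c p = l)
    (hirr : ∀ (e : P ⊕ D → ℕ) (m : ℕ), 0 < m → (∀ p, ∑ c, e c * A c p = m) →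
      (∀ c, e c ≤ x c) → m = l) :
    (2 : ℝ) ^ Fintype.card P * ∑ c, (x c : ℝ) ≤ ((Fintype.card D + 1 : ℕ) : ℝ) *
      (Fintype.card P * Real.sqrt ((Fintype.card P : ℝ) + 1) ^ (Fintype.card P + 1)) := by
  have hspan : Submodule.span ℝ (Set.range (fun c => (fun p => (A c p : ℝ)))) = ⊤ := by
    rw [eq_top_iff, ← (Pi.basisFun ℝ P).span_eq, Submodule.span_le]
    rintro _ ⟨p, rfl⟩
    refine Submodule.subset_span ⟨Sum.inl p, ?_⟩
    ext p'
    simp [hI, Pi.single_apply, eq_comm]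
  have hxlR : ∀ p, ∑ c, (x c : ℝ) * A c p = l := fun p => by exact_mod_cast hxl p
  obtain ⟨p0⟩ := id ‹Nonempty P›
  rcases Nat.eq_zero_or_pos l with h0 | hl
  · have : ∀ c, x c = 0 := by
      intro c
      obtain ⟨p, hp⟩ := hne c
      have h := hxl p
      rw [h0, Finset.sum_eq_zero_iff] at h
      simpa [hp] using h c (mem_univ _)
    simp only [this, Nat.cast_zero, Finset.sum_const_zero, mul_zero]
    positivity
  -- any integral solution below x equals x
  have heq : ∀ (e : P ⊕ D → ℕ) (m : ℕ), 0 < m → (∀ p, ∑ c, e c * A c p = m) →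
      (∀ c, e c ≤ x c) → e = x := by
    intro e m hm he hex
    have hml := hirr e m hm he hex
    ext c
    obtain ⟨p, hp⟩ := hne c
    have h := (he p).trans (hml.trans (hxl p).symm)
    rw [Finset.sum_eq_sum_iff_of_le (fun c _ => Nat.mul_le_mul_right _ (hex c))] at h
    simpa [hp] using h c (mem_univ _)
  by_cases hno : ∃ (e : P ⊕ D → ℕ) (m : ℕ), 0 < m ∧ (∀ p, ∑ c, e c * A c p = m) ∧ 
      (∀ c, (e c : ℝ) ≤ (x c : ℝ)) ∧ (2 : ℝ) ^ Fintype.card P * ∑ c, (e c : ℝ) ≤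
        Fintype.card P * Real.sqrt ((Fintype.card P : ℝ) + 1) ^ (Fintype.card P + 1)
  · obtain ⟨e, m, hm, he, hex, hb⟩ := hno
    have : e = x := heq e m hm he (fun c => by exact_mod_cast hex c)
    subst this
    refine hb.trans ?_
    have h1 : (1 : ℝ) ≤ ((Fintype.card D + 1 : ℕ) : ℝ) := by
      push_cast
      linarith [(Nat.cast_nonneg (Fintype.card D) : (0 : ℝ) ≤ _)]
    exact le_mul_of_one_le_left (by positivity) h1
  · exact peel A hA hne hspan _ (fun c => (x c : ℝ)) (fun c => Nat.cast_nonneg _) l hxlR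
      (finrank_cone A hI _) hno
open scoped LinearAlgebra.Projectivization

theorem rep_mem_iff {K V : Type*} [Field K] [AddCommGroup V] [Module K V] (W : Submodule K V)
    (v : V) (hv : v ≠ 0) : (Projectivization.mk K v hv).rep ∈ W ↔ v ∈ W := by
  obtain ⟨a, ha⟩ := Projectivization.exists_smul_eq_mk_rep K v hv
  rw [← ha]
  exact Submodule.smul_mem_iff' W a

theorem mk_ne_aux {K V : Type*} [Field K] [AddCommGroup V] [Module K V] {v w : V}
    (hv : v ≠ 0) (hw : w ≠ 0) (h : v ∉ Submodule.span K {w}) :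
    Projectivization.mk K v hv ≠ Projectivization.mk K w hw := by
  intro h'
  rw [Projectivization.mk_eq_mk_iff'] at h'
  obtain ⟨a, ha⟩ := h'
  exact h (Submodule.mem_span_singleton.mpr ⟨a, ha⟩)

/-- a subspace of dimension at least two is not contained in a line -/
theorem exists_not_mem_span {K V : Type*} [Field K] [AddCommGroup V] [Module K V]
    (W : Submodule K V) (hW : 2 ≤ Module.finrank K W) (v : V) :
    ∃ u ∈ W, u ∉ Submodule.span K {v} := by
  by_contra! h
  have h1 : W ≤ Submodule.span K {v} := h
  have h2 := Submodule.finrank_mono h1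
  have h3 := finrank_span_le_card (R := K) ({v} : Set V)
  simp only [Set.toFinset_singleton, Finset.card_singleton] at h3
  omega

theorem three_points {K V : Type*} [Field K] [AddCommGroup V] [Module K V] [Finite V]
    (W W' : Submodule K V) (hW : 2 ≤ Module.finrank K W) (hW' : 2 ≤ Module.finrank K W')
    (hle : Module.finrank K W' ≤ Module.finrank K W) (hne : W ≠ W') :
    ∃ a b c : ℙ K V, a ≠ b ∧ a ≠ c ∧ b ≠ c ∧ ¬ (a.rep ∈ W ↔ a.rep ∈ W') ∧
      ¬ (b.rep ∈ W ↔ b.rep ∈ W') ∧ ¬ (c.rep ∈ W ↔ c.rep ∈ W') := by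
  have hn : ¬ W ≤ W' := fun h => hne (Submodule.eq_of_le_of_finrank_le h hle)
  obtain ⟨v, hv, hv'⟩ := SetLike.not_le_iff_exists.mp hn
  have hne0 : ∀ {X : Submodule K V} {z : V}, z ∉ X → z ≠ 0 := by
    rintro X z hz rfl
    exact hz X.zero_mem
  -- `v + s` and `v + t` are projectively different when `s ≠ t` in `W'`
  have hdiff : ∀ s ∈ W', ∀ t ∈ W', s ≠ t → v + s ∉ Submodule.span K {v + t} := by
    intro s hs t ht hst h
    obtain ⟨a, ha⟩ := Submodule.mem_span_singleton.mp h
    by_cases h1 : a = 1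
    · subst h1
      rw [one_smul] at ha
      exact hst (add_left_cancel ha).symm
    · apply hv'
      have h2 : (a - 1) • v = s - a • t := by
        have : a • v + a • t = v + s := by rw [← smul_add, ha]
        rw [sub_smul, one_smul, sub_eq_sub_iff_add_eq_add, this, add_comm]
      have h3 : (a - 1) • v ∈ W' := by
        rw [h2]; exact W'.sub_mem hs (W'.smul_mem _ ht)
      exact (W'.smul_mem_iff (sub_ne_zero.mpr h1)).mp h3
  have hnot : ∀ s ∈ W', v + s ∉ W' := fun s hs h => hv' ((W'.add_mem_iff_left hs).mp h)
  by_cases hcase : W' ≤ W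
  · obtain ⟨u, hu, hu'⟩ := exists_not_mem_span W' hW' (0 : V)
    obtain ⟨w, hw, hw'⟩ := exists_not_mem_span W' hW' u
    have hu0 : u ≠ 0 := hne0 hu'
    have hw0 : w ≠ 0 := hne0 hw'
    have huw : u ≠ w := by
      rintro rfl
      exact hw' (Submodule.mem_span_singleton_self _)
    have h0 := hnot 0 W'.zero_mem
    have h1 := hnot u hu
    have h2 := hnot w hw
    refine ⟨.mk K _ (hne0 h0), .mk K _ (hne0 h1), .mk K _ (hne0 h2),
      mk_ne_aux _ _ (hdiff _ W'.zero_mem _ hu hu0.symm),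
      mk_ne_aux _ _ (hdiff _ W'.zero_mem _ hw hw0.symm),
      mk_ne_aux _ _ (hdiff _ hu _ hw huw), ?_, ?_, ?_⟩
    · rw [rep_mem_iff, rep_mem_iff]
      exact fun h => h0 (h.mp (W.add_mem hv (hcase W'.zero_mem)))
    · rw [rep_mem_iff, rep_mem_iff]
      exact fun h => h1 (h.mp (W.add_mem hv (hcase hu)))
    · rw [rep_mem_iff, rep_mem_iff]
      exact fun h => h2 (h.mp (W.add_mem hv (hcase hw)))
  · obtain ⟨v', hv1, hv2⟩ := SetLike.not_le_iff_exists.mp hcase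
    obtain ⟨z, hz, hz', hzv⟩ : ∃ z ∈ W, z ∉ W' ∧ z ∉ Submodule.span K {v} := by
      obtain ⟨u, hu, hu'⟩ := exists_not_mem_span W hW v
      by_cases h : u ∈ W'
      · refine ⟨v + u, W.add_mem hv hu, hnot u h, ?_⟩
        have := hdiff u h 0 W'.zero_mem (hne0 hu')
        simpa using this
      · exact ⟨u, hu, h, hu'⟩
    have hsp : ∀ {y : V}, y ∈ W → v' ∉ Submodule.span K {y} := by
      intro y hy h
      exact hv2 ((Submodule.span_singleton_le_iff_mem y W).mpr hy h)
    refine ⟨.mk K v' (hne0 hv2), .mk K z (hne0 hz'), .mk K v (hne0 hv'),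
      mk_ne_aux _ _ (hsp hz), mk_ne_aux _ _ (hsp hv), mk_ne_aux _ _ hzv, ?_, ?_, ?_⟩
    · rw [rep_mem_iff, rep_mem_iff]; tauto
    · rw [rep_mem_iff, rep_mem_iff]; tauto
    · rw [rep_mem_iff, rep_mem_iff]; tauto

theorem card_subspaces_le {K V : Type*} [Field K] [AddCommGroup V] [Module K V] [Finite V]
    [Fintype (ℙ K V)] :
    Nat.card {W : Submodule K V // 2 ≤ Module.finrank K W} * Fintype.card (ℙ K V) ≤
      2 ^ Fintype.card (ℙ K V) := by
  classical
  let φ : {W : Submodule K V // 2 ≤ Module.finrank K W} × ℙ K V → Finset (ℙ K V) :=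
    fun x => univ.filter (fun p => ¬ (p.rep ∈ x.1.1 ↔ p = x.2))
  have hφ : Function.Injective φ := by
    have main : ∀ x y, Module.finrank K y.1.1 ≤ Module.finrank K x.1.1 → φ x = φ y → x = y := by
      rintro ⟨⟨W, hW⟩, p⟩ ⟨⟨W', hW'⟩, p'⟩ hle h
      have h' : ∀ s : ℙ K V, (s.rep ∈ W ↔ s = p) ↔ (s.rep ∈ W' ↔ s = p') := by
        intro s
        have := congrArg (s ∈ ·) h
        simp only [φ, mem_filter, mem_univ, true_and, eq_iff_iff] at this
        exact not_iff_not.mp this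
      by_cases hne : W = W'
      · subst hne
        have := h' p
        have h2 : p = p' := by
          tauto
        subst h2
        rfl
      · exfalso
        obtain ⟨a, b, c, hab, hac, hbc, ha, hb, hc⟩ := three_points W W' hW hW' hle hne
        have key : ∀ s : ℙ K V, ¬ (s.rep ∈ W ↔ s.rep ∈ W') → s = p ∨ s = p' := by
          intro s hs
          have := h' s
          tauto
        rcases key a ha with h1 | h1 <;> rcases key b hb with h2 | h2 <;>
          rcases key c hc with h3 | h3 <;> simp_all
    intro x y h
    rcases le_total (Module.finrank K y.1.1) (Module.finrank K x.1.1) with h1 | h1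
    · exact main x y h1 h
    · exact (main y x h1 h.symm).symm
  have := Nat.card_le_card_of_injective φ hφ
  rw [Nat.card_prod, Nat.card_eq_fintype_card (α := ℙ K V),
    Nat.card_eq_fintype_card (α := Finset _), Fintype.card_finset] at this
  exact this

/-- If `V` is an `n`-dimensional vector space (`n ≥ 2`) over the finite field with `q` elements
(`q` a prime power), `t = (q^n − 1)/(q − 1)` is the number of one-dimensional subspaces of `V`,
and `(F, α)` is an irreducible `lam`-partition of `V` (each nonzero `v ∈ V` lies in `α f` for
exactly `lam` indices `f`, and no subset `F' ⊆ F` forms a `lam'`-partition with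
`0 < lam' < lam`), then `|F| ≤ (t+1)^((t+1)/2)`. -/
theorem irreducible_multipartition_card_le (q n : ℕ) (hq : IsPrimePow q) (hn : 2 ≤ n)
    (K : Type*) [Field K] [Fintype K] (hK : Fintype.card K = q)
    (V : Type*) [AddCommGroup V] [Module K V] (hdim : Module.finrank K V = n)
    (t : ℕ) (htq : t = (q ^ n - 1) / (q - 1))
    (F : Type*) [Fintype F] (α : F → Submodule K V) (hα : ∀ f, α f ≠ ⊥)
    (lam : ℕ) (hlam : 0 < lam)
    (hlevel : ∀ v : V, v ≠ 0 → Nat.card {f : F // v ∈ α f} = lam)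
    (hirr : ¬ ∃ (F' : Finset F) (lam' : ℕ), 0 < lam' ∧ lam' < lam ∧
      ∀ v : V, v ≠ 0 → Nat.card {f : F // f ∈ F' ∧ v ∈ α f} = lam') :
    (Fintype.card F : ℝ) ≤ ((t : ℝ) + 1) ^ (((t : ℝ) + 1) / 2) := by

  classical
  have : Module.Finite K V := Module.finite_of_finrank_pos (by omega)
  have : Finite V := Module.finite_of_finite K
  have := Fintype.ofFinite V
  have := Fintype.ofFinite (ℙ K V)
  have hnt : Nontrivial V := Module.nontrivial_of_finrank_pos (R := K) (by omega)
  obtain ⟨v0, hv0⟩ := exists_ne (0 : V)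
  have : Nonempty (ℙ K V) := ⟨.mk K v0 hv0⟩
  have ht : Fintype.card (ℙ K V) = t := by
    rw [← Nat.card_eq_fintype_card, Projectivization.card'', htq, Nat.card_eq_fintype_card,
      Nat.card_eq_fintype_card, Module.card_eq_pow_finrank (K := K), hK, hdim]
  have htpos : 0 < t := by rw [← ht]; exact Fintype.card_pos
  have hrhs : ((t : ℝ) + 1) ^ (((t : ℝ) + 1) / 2) = Real.sqrt ((t : ℝ) + 1) ^ (t + 1) := by
    rw [Real.sqrt_eq_rpow, ← Real.rpow_natCast, ← Real.rpow_mul (by positivity)]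
    congr 1
    push_cast
    ring
  rw [hrhs]
  have hlevel' : ∀ v : V, v ≠ 0 → (univ.filter (fun f => v ∈ α f)).card = lam := by
    intro v hv
    rw [← hlevel v hv, Nat.card_eq_fintype_card, Fintype.card_subtype]
  by_cases htop : ∃ f, α f = ⊤
  · -- a copy of the whole space
    obtain ⟨f0, hf0⟩ := htop
    have hlam1 : lam = 1 := by
      by_contra h
      refine hirr ⟨{f0}, 1, one_pos, by omega, fun v hv => ?_⟩
      rw [Nat.card_eq_fintype_card, Fintype.card_subtype, Finset.card_eq_one]
      refine ⟨f0, ?_⟩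
      ext f
      simp only [mem_filter, mem_univ, true_and, Finset.mem_singleton]
      constructor
      · exact fun h => h.1
      · rintro rfl
        simp [hf0]
    have hall : ∀ f, f = f0 := by
      intro f
      obtain ⟨v, hv, hv'⟩ := Submodule.exists_mem_ne_zero_of_ne_bot (hα f)
      have := hlevel' v hv'
      rw [hlam1, Finset.card_eq_one] at this
      obtain ⟨a, ha⟩ := this
      have h1 : f ∈ univ.filter (fun f => v ∈ α f) := by simpa using hv
      have h2 : f0 ∈ univ.filter (fun f => v ∈ α f) := by simp [hf0]
      rw [ha, Finset.mem_singleton] at h1 h2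
      rw [h1, h2]
    have hc : Fintype.card F = 1 := Fintype.card_eq_one_iff.mpr ⟨f0, hall⟩
    rw [hc, Nat.cast_one]
    apply one_le_pow₀
    rw [Real.one_le_sqrt]
    linarith [(Nat.cast_nonneg t : (0 : ℝ) ≤ t)]
  · push Not at htop
    let D := {W : Submodule K V // W ≠ ⊤ ∧ 2 ≤ Module.finrank K W}
    have : Fintype D := Fintype.ofFinite D
    have hD : (Fintype.card D + 1) * t ≤ 2 ^ t := by
      have h1 := card_subspaces_le (K := K) (V := V)
      rw [ht] at h1
      refine le_trans (Nat.mul_le_mul_right _ ?_) h1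
      let ψ : Option D → {W : Submodule K V // 2 ≤ Module.finrank K W} := fun o =>
        match o with
        | none => ⟨⊤, by rw [finrank_top]; omega⟩
        | some W => ⟨W.1, W.2.2⟩
      have hψ : Function.Injective ψ := by
        rintro (_ | ⟨W, hW⟩) (_ | ⟨W', hW'⟩) h
        · rfl
        · exact absurd (congrArg Subtype.val h).symm hW'.1
        · exact absurd (congrArg Subtype.val h) hW.1
        · have : W = W' := congrArg Subtype.val h
          subst this
          rfl
      have := Nat.card_le_card_of_injective ψ hψ
      rwa [Nat.card_eq_fintype_card, Fintype.card_option] at this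
    let sub : ℙ K V ⊕ D → Submodule K V := Sum.elim (fun p => p.submodule) (fun W => W.1)
    have hcls : ∀ f, ∃ c, sub c = α f := by
      intro f
      have h0 : Module.finrank K (α f) ≠ 0 := by
        rw [Ne, Submodule.finrank_eq_zero]
        exact hα f
      by_cases h1 : Module.finrank K (α f) = 1
      · exact ⟨Sum.inl (Projectivization.mk'' (α f) h1), Projectivization.submodule_mk'' _ _⟩
      · exact ⟨Sum.inr ⟨α f, htop f, by omega⟩, rfl⟩
    choose cl hcl using hcls
    have hsubne : ∀ c, sub c ≠ ⊥ := by
      rintro (p | W) h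
      · have := Projectivization.finrank_submodule p
        simp only [sub, Sum.elim_inl] at h
        rw [h, finrank_bot] at this
        omega
      · have := W.2.2
        simp only [sub, Sum.elim_inr] at h
        rw [h, finrank_bot] at this
        omega
    let A : ℙ K V ⊕ D → ℙ K V → ℕ := fun c p => if p.rep ∈ sub c then 1 else 0
    let x : ℙ K V ⊕ D → ℕ := fun c => (univ.filter (fun f => cl f = c)).card
    have hsumA : ∀ (G : Finset F) (p : ℙ K V),
        ∑ c, (G.filter (fun f => cl f = c)).card * A c p =
          (G.filter (fun f => p.rep ∈ α f)).card := by
      intro G p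
      rw [Finset.card_filter, ← Finset.sum_fiberwise G cl]
      refine Finset.sum_congr rfl (fun c _ => ?_)
      rw [Finset.card_eq_sum_ones, Finset.sum_mul]
      refine Finset.sum_congr rfl (fun f hf => ?_)
      rw [Finset.mem_filter] at hf
      simp [A, ← hf.2, hcl]
    have hxl : ∀ p, ∑ c, x c * A c p = lam := by
      intro p
      rw [hsumA univ p]
      exact hlevel' _ p.rep_nonzero
    have hmain := abstract_bound A
      (by intro c p; by_cases h : p.rep ∈ sub c <;> simp [A, h])
      (by
        intro c
        obtain ⟨v, hv, hv'⟩ := Submodule.exists_mem_ne_zero_of_ne_bot (hsubne c)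
        refine ⟨.mk K v hv', ?_⟩
        simp only [A]
        rw [if_pos]
        rwa [rep_mem_iff])
      (by
        intro p p'
        simp only [A, sub, Sum.elim_inl]
        congr 1
        rw [Projectivization.submodule_eq, Submodule.mem_span_singleton, eq_comm (a := p),
          eq_iff_iff]
        conv_rhs => rw [← p.mk_rep, ← p'.mk_rep]
        rw [Projectivization.mk_eq_mk_iff'])
      x lam hxl
      (by
        intro e m hm he hex
        choose G hG1 hG2 using fun c => Finset.exists_subset_card_eq (hex c)
        let F' : Finset F := univ.filter (fun f => f ∈ G (cl f))
        have hfib : ∀ c, F'.filter (fun f => cl f = c) = G c := by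
          intro c
          ext f
          simp only [F', mem_filter, mem_univ, true_and]
          constructor
          · rintro ⟨h, rfl⟩
            exact h
          · intro h
            have := hG1 c h
            simp only [mem_filter, mem_univ, true_and] at this
            subst this
            exact ⟨h, rfl⟩
        have hF' : ∀ p : ℙ K V, (F'.filter (fun f => p.rep ∈ α f)).card = m := by
          intro p
          rw [← hsumA F' p, ← he p]
          refine Finset.sum_congr rfl (fun c _ => ?_)
          rw [hfib, hG2]
        have hml : m ≤ lam := by
          let p0 : ℙ K V := .mk K v0 hv0
          rw [← he p0, ← hxl p0]
          exact Finset.sum_le_sum (fun c _ => Nat.mul_le_mul_right _ (hex c))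
        by_contra hne
        refine hirr ⟨F', m, hm, by omega, fun v hv => ?_⟩
        rw [← hF' (.mk K v hv), Nat.card_eq_fintype_card, Fintype.card_subtype]
        congr 1
        ext f
        simp only [mem_filter, mem_univ, true_and, rep_mem_iff])
    have hxF : ∑ c, (x c : ℝ) = Fintype.card F := by
      have : ∑ c, x c = Fintype.card F := by
        simp only [x]
        rw [← Finset.card_univ (α := F)]
        exact (Finset.card_eq_sum_card_fiberwise (fun f _ => Finset.mem_coe.mpr (mem_univ _))).symm
      exact_mod_cast this
    rw [hxF, ht] at hmain
    have hDR : ((Fintype.card D + 1 : ℕ) : ℝ) * t ≤ 2 ^ t := by exact_mod_cast hD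
    have hH : (0 : ℝ) ≤ Real.sqrt ((t : ℝ) + 1) ^ (t + 1) := by positivity
    rw [← mul_assoc] at hmain
    have h2 := hmain.trans (mul_le_mul_of_nonneg_right hDR hH)
    exact le_of_mul_le_mul_left h2 (by positivity)
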